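/- arXiv:2110.13615 — 2 statements merged into one kernel-verified Lean document; each statement's English description precedes it below -/
import Mathlib

section
/- The symmedian point of the first CCP solution triangle T1 coincides with the Gergonne point of the reference triangle ABC: the point with barycentric coordinates [x²:y²:z²] with respect to (V1,V2,V3), where x = dist(V2,V3), y = dist(V3,V1), z = dist(V1,V2), equals the point with barycentric coordinates [1/u : 1/v : 1/w] with respect to (A,B,C). -/
open EuclideanGeometry

/-- The point with barycentric coordinates `[x : y : z]` with respect to `(A, B, C)`. -/
noncomputable def bary (A B C : EuclideanSpace ℝ (Fin 2)) (x y z : ℝ) :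
    EuclideanSpace ℝ (Fin 2) :=
  (x + y + z)⁻¹ • (x • A + y • B + z • C)

theorem bary_smul_weights (A B C : EuclideanSpace ℝ (Fin 2)) {k : ℝ} (hk : k ≠ 0) (x y z : ℝ) :
    bary A B C (k * x) (k * y) (k * z) = bary A B C x y z := by
  simp only [bary, ← mul_add, mul_inv, mul_smul, ← smul_add]
  rw [smul_comm, inv_smul_smul₀ hk]

/-- If each weight of a barycentric combination of three normalised points is a multiple of the
total of that point's own weights, the normalisations cancel. -/
theorem bary_bary (A B C : EuclideanSpace ℝ (Fin 2)) {p₁ q₁ r₁ p₂ q₂ r₂ p₃ q₃ r₃ : ℝ}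
    (h₁ : p₁ + q₁ + r₁ ≠ 0) (h₂ : p₂ + q₂ + r₂ ≠ 0) (h₃ : p₃ + q₃ + r₃ ≠ 0) (k₁ k₂ k₃ : ℝ) :
    bary (bary A B C p₁ q₁ r₁) (bary A B C p₂ q₂ r₂) (bary A B C p₃ q₃ r₃)
      (k₁ * (p₁ + q₁ + r₁)) (k₂ * (p₂ + q₂ + r₂)) (k₃ * (p₃ + q₃ + r₃)) =
    bary A B C (k₁ * p₁ + k₂ * p₂ + k₃ * p₃) (k₁ * q₁ + k₂ * q₂ + k₃ * q₃)
      (k₁ * r₁ + k₂ * r₂ + k₃ * r₃) := by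
  simp only [bary, mul_smul, smul_inv_smul₀ h₁, smul_inv_smul₀ h₂, smul_inv_smul₀ h₃]
  congr 1
  · congr 1
    ring
  · module

/-- The distance formula in barycentric coordinates. -/
theorem dist_bary_sq_mul (A B C : EuclideanSpace ℝ (Fin 2)) {p q r p' q' r' : ℝ}
    (h : p + q + r ≠ 0) (h' : p' + q' + r' ≠ 0) :
    dist (bary A B C p q r) (bary A B C p' q' r') ^ 2 *
        ((p + q + r) * (p' + q' + r')) ^ 2 =
      -(dist B C ^ 2 * (q * (p' + r') - q' * (p + r)) * (r * (p' + q') - r' * (p + q)) +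
        dist C A ^ 2 * (r * (p' + q') - r' * (p + q)) * (p * (q' + r') - p' * (q + r)) +
        dist A B ^ 2 * (p * (q' + r') - p' * (q + r)) * (q * (p' + r') - q' * (p + r))) := by
  simp only [EuclideanSpace.dist_eq, Real.dist_eq, sq_abs, Fin.sum_univ_two]
  repeat rw [Real.sq_sqrt (by positivity)]
  simp only [bary, PiLp.smul_apply, PiLp.add_apply, smul_eq_mul]
  field_simp
  ring

theorem dist_lt_dist_add_dist_of_affineIndependent {A B C : EuclideanSpace ℝ (Fin 2)}
    (h : AffineIndependent ℝ ![A, B, C]) : dist A C < dist A B + dist B C := by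
  refine lt_of_le_of_ne (dist_triangle A B C) fun heq => ?_
  exact affineIndependent_iff_not_collinear_set.1 h (dist_add_dist_eq_iff.1 heq.symm).collinear

/-- The symmedian point of the first CCP solution triangle `T1 = (V1, V2, V3)` coincides
with the Gergonne point of the reference triangle `ABC`. -/
theorem ccp_first_solution_symmedian_eq_gergonne
    (A B C : EuclideanSpace ℝ (Fin 2)) (hABC : AffineIndependent ℝ ![A, B, C])
    (a b c s u v w φ : ℝ)
    (ha : a = dist B C) (hb : b = dist C A) (hc : c = dist A B)
    (hs : s = (a + b + c) / 2)
    (hu : u = s - a) (hv : v = s - b) (hw : w = s - c)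
    (hφ : φ = (1 + Real.sqrt 5) / 2)
    (V1 V2 V3 : EuclideanSpace ℝ (Fin 2))
    (hV1 : V1 = bary A B C (φ ^ 2 / u) (1 / v) ((φ - 1) ^ 2 / w))
    (hV2 : V2 = bary A B C ((φ - 2) ^ 2 / u) (1 / v) ((φ - 1) ^ 2 / w))
    (hV3 : V3 = bary A B C ((φ - 2) ^ 2 / u) ((2 * φ - 3) ^ 2 / v) ((φ - 1) ^ 2 / w))
    (x y z : ℝ)
    (hx : x = dist V2 V3) (hy : y = dist V3 V1) (hz : z = dist V1 V2) :
    bary V1 V2 V3 (x ^ 2) (y ^ 2) (z ^ 2) = bary A B C (1 / u) (1 / v) (1 / w) := by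
  have hu0 : 0 < u := by
    have := dist_lt_dist_add_dist_of_affineIndependent (A := B) (B := A) (C := C)
      (by simpa [affineIndependent_iff_not_collinear_set, Set.insert_comm] using hABC)
    rw [dist_comm B A, dist_comm A C] at this
    linarith
  have hv0 : 0 < v := by
    have := dist_lt_dist_add_dist_of_affineIndependent hABC
    rw [dist_comm A C] at this
    linarith
  have hw0 : 0 < w := by
    have := dist_lt_dist_add_dist_of_affineIndependent (A := A) (B := C) (C := B)
      (by simpa [affineIndependent_iff_not_collinear_set, Set.pair_comm] using hABC)
    rw [dist_comm A C, dist_comm C B] at this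
    linarith
  have hφ2 : φ ^ 2 = φ + 1 := by
    have := Real.sq_sqrt (show (0 : ℝ) ≤ 5 by norm_num)
    rw [hφ]
    linarith
  have hφ1 : 1 < φ := by
    have := Real.lt_sqrt_of_sq_lt (show (1 : ℝ) ^ 2 < 5 by norm_num)
    linarith
  have ha' : dist B C = v + w := by linarith
  have hb' : dist C A = w + u := by linarith
  have hc' : dist A B = u + v := by linarith
  have hφ0 : 0 < φ - 1 := by linarith
  have hS₁ : 0 < φ ^ 2 / u + 1 / v + (φ - 1) ^ 2 / w := by positivity
  have hS₂ : 0 < (φ - 2) ^ 2 / u + 1 / v + (φ - 1) ^ 2 / w := by positivity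
  have hS₃ : 0 < (φ - 2) ^ 2 / u + (2 * φ - 3) ^ 2 / v + (φ - 1) ^ 2 / w := by positivity
  have e₁ : (φ - 1) ^ 2 = 2 - φ := by linear_combination hφ2
  have e₂ : (φ - 2) ^ 2 = 5 - 3 * φ := by linear_combination hφ2
  have e₃ : (2 * φ - 3) ^ 2 = 13 - 8 * φ := by linear_combination 4 * hφ2
  simp only [hφ2, e₁, e₂, e₃] at hV1 hV2 hV3 hS₁ hS₂ hS₃
  have hφ3 : φ ^ 3 = 2 * φ + 1 := by linear_combination (φ + 1) * hφ2
  have hφ4 : φ ^ 4 = 3 * φ + 2 := by linear_combination (φ ^ 2 + φ + 2) * hφ2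
  have hφ5 : φ ^ 5 = 5 * φ + 3 := by linear_combination (φ ^ 3 + φ ^ 2 + 2 * φ + 3) * hφ2
  have hz2 := dist_bary_sq_mul A B C hS₁.ne' hS₂.ne'
  have hx2 := dist_bary_sq_mul A B C hS₂.ne' hS₃.ne'
  have hy2 := dist_bary_sq_mul A B C hS₃.ne' hS₁.ne'
  rw [← hV1, ← hV2, ← hz, ha', hb', hc'] at hz2
  rw [← hV2, ← hV3, ← hx, ha', hb', hc'] at hx2
  rw [← hV3, ← hV1, ← hy, ha', hb', hc'] at hy2
  set S₁ := (φ + 1) / u + 1 / v + (2 - φ) / w with hS₁_def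
  set S₂ := (5 - 3 * φ) / u + 1 / v + (2 - φ) / w with hS₂_def
  set S₃ := (5 - 3 * φ) / u + (13 - 8 * φ) / v + (2 - φ) / w with hS₃_def
  have hz' : z ^ 2 * (S₁ * S₂) ^ 2 = (4 * φ - 4) ^ 2 * (S₁ * S₂) := by
    rw [hz2, hS₁_def, hS₂_def]
    field_simp
    ring_nf
    simp only [hφ4, hφ3, hφ2]
    ring
  have hx' : x ^ 2 * (S₂ * S₃) ^ 2 = (5 - 3 * φ) * (4 * φ - 4) ^ 2 * (S₂ * S₃) := by
    rw [hx2, hS₂_def, hS₃_def]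
    field_simp
    ring_nf
    simp only [hφ5, hφ4, hφ3, hφ2]
    ring
  have hy' : y ^ 2 * (S₃ * S₁) ^ 2 = (2 - φ) * (4 * φ - 4) ^ 2 * (S₃ * S₁) := by
    rw [hy2, hS₃_def, hS₁_def]
    field_simp
    ring_nf
    simp only [hφ5, hφ4, hφ3, hφ2]
    ring
  set K := (4 * φ - 4) ^ 2 / (S₁ * S₂ * S₃)
  have hK : 0 < K := by
    have : 0 < 4 * φ - 4 := by linarith
    positivity
  have hK_mul : K * (S₁ * S₂ * S₃) = (4 * φ - 4) ^ 2 := div_mul_cancel₀ _ (by positivity)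
  have x_sq : x ^ 2 = K * (5 - 3 * φ) * S₁ := by
    refine mul_right_cancel₀ (pow_ne_zero 2 (mul_pos hS₂ hS₃).ne') (hx'.trans ?_)
    rw [← hK_mul]
    ring
  have y_sq : y ^ 2 = K * (2 - φ) * S₂ := by
    refine mul_right_cancel₀ (pow_ne_zero 2 (mul_pos hS₃ hS₁).ne') (hy'.trans ?_)
    rw [← hK_mul]
    ring
  have z_sq : z ^ 2 = K * S₃ := by
    refine mul_right_cancel₀ (pow_ne_zero 2 (mul_pos hS₁ hS₂).ne') (hz'.trans ?_)
    rw [← hK_mul]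
    ring
  clear_value K S₁ S₂ S₃
  have hk : K * (20 - 12 * φ) ≠ 0 := by
    have : 20 - 12 * φ = 4 * (φ - 1) ^ 4 := by
      linear_combination -4 * (φ ^ 2 - 3 * φ + 4) * hφ2
    rw [this]
    positivity
  rw [x_sq, y_sq, z_sq, hV1, hV2, hV3, hS₁_def, hS₂_def, hS₃_def,
    bary_bary A B C (hS₁_def ▸ hS₁.ne') (hS₂_def ▸ hS₂.ne') (hS₃_def ▸ hS₃.ne'),
    ← bary_smul_weights A B C hk (1 / u)]
  congr 1
  · ring
  · ring
  · linear_combination 4 * K / w * hφ2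
end

section
/- The two CCP solution triangles T1 and T2 share their Brocard inellipse: there exists ρ > 0 such that for each of the six side lines ℓ of T1 and T2 (the lines V1V2, V2V3, V3V1, W1W2, W2W3, W3W1), one has infDist(Ω1, ℓ) · infDist(Ω2, ℓ) = ρ², where Ω1 = [α/u : β/v : γ/w] and Ω2 = [γ/u : α/v : β/w] with respect to (A,B,C), with α = (a−b)² − (a+b)c, β = (b−c)² − (b+c)a, γ = (c−a)² − (c+a)b; i.e. all six sides are tangent to the ellipse with foci Ω1, Ω2 and minor semi-axis ρ. -/
open EuclideanGeometry

/-- Twice the signed area of the triangle `ABC`. -/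
noncomputable def doubleArea (A B C : EuclideanSpace ℝ (Fin 2)) : ℝ :=
  (B 0 - A 0) * (C 1 - A 1) - (B 1 - A 1) * (C 0 - A 0)

lemma bary_apply (A B C : EuclideanSpace ℝ (Fin 2)) (x y z : ℝ) (i : Fin 2) :
    bary A B C x y z i = (x + y + z)⁻¹ * (x * A i + y * B i + z * C i) := by
  simp [bary, mul_add, add_assoc]

lemma bary_rotate (A B C : EuclideanSpace ℝ (Fin 2)) (x y z : ℝ) :
    bary A B C x y z = bary B C A y z x := by
  ext i
  rw [bary_apply, bary_apply]
  ring

lemma dist_sq_eq_coord (P Q : EuclideanSpace ℝ (Fin 2)) :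
    dist P Q ^ 2 = (P 0 - Q 0) ^ 2 + (P 1 - Q 1) ^ 2 := by
  rw [EuclideanSpace.dist_eq, Real.sq_sqrt (by positivity)]
  simp [Fin.sum_univ_two, Real.dist_eq, sq_abs]

/-- The distance from a point to a line given by an equation `m * X 0 + n * X 1 + k = 0`. -/
lemma infDist_line_mul_sqrt {P Q : EuclideanSpace ℝ (Fin 2)} (hPQ : P ≠ Q) {m n k : ℝ}
    (hP : m * P 0 + n * P 1 + k = 0) (hQ : m * Q 0 + n * Q 1 + k = 0)
    (X : EuclideanSpace ℝ (Fin 2)) :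
    Metric.infDist X (affineSpan ℝ {P, Q} : Set (EuclideanSpace ℝ (Fin 2))) *
      Real.sqrt (m ^ 2 + n ^ 2) = |m * X 0 + n * X 1 + k| := by
  have hd : 0 < (P 0 - Q 0) ^ 2 + (P 1 - Q 1) ^ 2 := by
    rw [← dist_sq_eq_coord]
    have := dist_pos.2 hPQ
    positivity
  have hcoord (t : ℝ) (i : Fin 2) :
      AffineMap.lineMap P Q t i = P i + t * (Q i - P i) := by
    simp [AffineMap.lineMap_apply]
    ring
  have hne : ((affineSpan ℝ {P, Q} : AffineSubspace ℝ (EuclideanSpace ℝ (Fin 2))) :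
      Set (EuclideanSpace ℝ (Fin 2))).Nonempty :=
    ⟨P, left_mem_affineSpan_pair ℝ P Q⟩
  rcases eq_or_lt_of_le (Real.sqrt_nonneg (m ^ 2 + n ^ 2)) with h0 | h0
  · have h := (Real.sqrt_eq_zero (by positivity)).1 h0.symm
    have hm : m = 0 := by nlinarith [sq_nonneg m, sq_nonneg n]
    have hn : n = 0 := by nlinarith [sq_nonneg m, sq_nonneg n]
    subst hm hn
    have hk : k = 0 := by linarith
    simp [hk]
  · apply le_antisymm
    · set d := (P 0 - Q 0) ^ 2 + (P 1 - Q 1) ^ 2 with hd_def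
      set t := ((X 0 - P 0) * (Q 0 - P 0) + (X 1 - P 1) * (Q 1 - P 1)) / d with ht
      have htd : t * d = (X 0 - P 0) * (Q 0 - P 0) + (X 1 - P 1) * (Q 1 - P 1) :=
        div_mul_cancel₀ _ hd.ne'
      refine (mul_le_mul_of_nonneg_right (Metric.infDist_le_dist_of_mem
        (AffineMap.lineMap_mem_affineSpan_pair t P Q)) h0.le).trans ?_
      apply abs_le_of_sq_le_sq' _ (abs_nonneg _) |>.2
      rw [sq_abs, mul_pow, dist_sq_eq_coord, Real.sq_sqrt (by positivity), hcoord, hcoord]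
      have hk : k = -(m * P 0 + n * P 1) := by linarith
      have hmn : m * (Q 0 - P 0) + n * (Q 1 - P 1) = 0 := by linarith
      obtain ⟨r, hm, hn⟩ : ∃ r, m = -r * (Q 1 - P 1) ∧ n = r * (Q 0 - P 0) := by
        refine ⟨(n * (Q 0 - P 0) - m * (Q 1 - P 1)) / d, ?_, ?_⟩
        · field_simp
          rw [hd_def]
          linear_combination (Q 0 - P 0) * hmn
        · field_simp
          rw [hd_def]
          linear_combination (Q 1 - P 1) * hmn
      rw [hk, hm, hn]
      apply le_of_eq
      linear_combination (r ^ 2 * (t * d - ((X 0 - P 0) * (Q 0 - P 0)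
        + (X 1 - P 1) * (Q 1 - P 1)))) * htd
    · rw [← div_le_iff₀ h0]
      refine (Metric.le_infDist hne).2 fun Y hY => ?_
      obtain ⟨t, rfl⟩ := mem_affineSpan_pair_iff_exists_lineMap_eq.1 hY
      rw [div_le_iff₀ h0]
      refine (abs_le_of_sq_le_sq' ?_ (by positivity)).2
      rw [sq_abs, mul_pow, dist_sq_eq_coord, Real.sq_sqrt (by positivity), hcoord, hcoord]
      have hXY : m * X 0 + n * X 1 + k =
          m * (X 0 - (P 0 + t * (Q 0 - P 0))) + n * (X 1 - (P 1 + t * (Q 1 - P 1))) := by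
        linear_combination (1 - t) * hP + t * hQ
      rw [hXY]
      nlinarith [sq_nonneg (n * (X 0 - (P 0 + t * (Q 0 - P 0)))
        - m * (X 1 - (P 1 + t * (Q 1 - P 1))))]

lemma bary_ne_bary {A B C : EuclideanSpace ℝ (Fin 2)} (hD : doubleArea A B C ≠ 0)
    {x y z x' y' z' : ℝ} (h : x + y + z ≠ 0) (h' : x' + y' + z' ≠ 0)
    (hxy : x * y' ≠ x' * y) : bary A B C x y z ≠ bary A B C x' y' z' := by
  intro heq
  have h0 := congrArg (fun X : EuclideanSpace ℝ (Fin 2) => X 0) heq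
  have h1 := congrArg (fun X : EuclideanSpace ℝ (Fin 2) => X 1) heq
  simp only [bary_apply] at h0 h1
  field_simp at h0 h1
  unfold doubleArea at hD
  have hx : ((B 0 - A 0) * (C 1 - A 1) - (B 1 - A 1) * (C 0 - A 0)) *
      (x * (x' + y' + z') - x' * (x + y + z)) = 0 := by
    linear_combination (B 1 - C 1) * h0 - (B 0 - C 0) * h1
  have hy : ((B 0 - A 0) * (C 1 - A 1) - (B 1 - A 1) * (C 0 - A 0)) *
      (y * (x' + y' + z') - y' * (x + y + z)) = 0 := by
    linear_combination (C 1 - A 1) * h0 - (C 0 - A 0) * h1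
  have hx' := (mul_eq_zero.1 hx).resolve_left hD
  have hy' := (mul_eq_zero.1 hy).resolve_left hD
  have : (x * y' - x' * y) * (x + y + z) = 0 := by
    linear_combination -x * hy' + y * hx'
  exact hxy (sub_eq_zero.1 ((mul_eq_zero.1 this).resolve_right h))

lemma doubleArea_sq {A B C : EuclideanSpace ℝ (Fin 2)} {u v w : ℝ}
    (ha : dist B C = v + w) (hb : dist C A = w + u) (hc : dist A B = u + v) :
    doubleArea A B C ^ 2 = 4 * ((u + v + w) * u * v * w) := by
  have ha2 := dist_sq_eq_coord B C
  have hb2 := dist_sq_eq_coord C A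
  have hc2 := dist_sq_eq_coord A B
  rw [ha] at ha2
  rw [hb] at hb2
  rw [hc] at hc2
  have hdot : 2 * ((B 0 - A 0) * (C 0 - A 0) + (B 1 - A 1) * (C 1 - A 1)) =
      (u + v) ^ 2 + (w + u) ^ 2 - (v + w) ^ 2 := by
    rw [ha2, hb2, hc2]
    ring
  have hlag : 4 * doubleArea A B C ^ 2 = 4 * (u + v) ^ 2 * (w + u) ^ 2
      - (2 * ((B 0 - A 0) * (C 0 - A 0) + (B 1 - A 1) * (C 1 - A 1))) ^ 2 := by
    rw [hc2, hb2, doubleArea]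
    ring
  rw [hdot] at hlag
  linear_combination hlag / 4

/-- The product of the distances from the two foci to the line `v y = t w z`, for a root `t` of
`t² - 3 * t + 1`. -/
lemma infDist_mul_infDist_side {A B C : EuclideanSpace ℝ (Fin 2)} {u v w : ℝ}
    (hu : 0 < u) (hv : 0 < v) (hw : 0 < w)
    (ha : dist B C = v + w) (hb : dist C A = w + u) (hc : dist A B = u + v)
    {t : ℝ} (ht : 0 < t) (ht2 : t ^ 2 + 1 = 3 * t)
    {α β γ : ℝ} (hα : α = -2 * (2 * u * v + v * w + w * u))
    (hβ : β = -2 * (u * v + 2 * v * w + w * u)) (hγ : γ = -2 * (u * v + v * w + 2 * w * u))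
    {x y z x' y' z' : ℝ} (hsum : x + y + z ≠ 0) (hsum' : x' + y' + z' ≠ 0)
    (hyz : v * y = t * w * z) (hyz' : v * y' = t * w * z') (hxy : x * y' ≠ x' * y) :
    Metric.infDist (bary A B C (α / u) (β / v) (γ / w))
        (affineSpan ℝ {bary A B C x y z, bary A B C x' y' z'} :
          Set (EuclideanSpace ℝ (Fin 2))) *
      Metric.infDist (bary A B C (γ / u) (α / v) (β / w))
        (affineSpan ℝ {bary A B C x y z, bary A B C x' y' z'} :
          Set (EuclideanSpace ℝ (Fin 2))) =
      16 * ((u + v + w) * u * v * w) /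
        ((α / u + β / v + γ / w) * (γ / u + α / v + β / w)) := by
  have hD2 := doubleArea_sq ha hb hc
  have hD : doubleArea A B C ≠ 0 := by
    intro h
    rw [h] at hD2
    have : 0 < (u + v + w) * u * v * w := by positivity
    linarith
  have hαneg : α < 0 := by
    have : 0 < 2 * u * v + v * w + w * u := by positivity
    linarith
  have hβneg : β < 0 := by
    have : 0 < u * v + 2 * v * w + w * u := by positivity
    linarith
  have hγneg : γ < 0 := by
    have : 0 < u * v + v * w + 2 * w * u := by positivity
    linarith
  have hS₁ : α / u + β / v + γ / w < 0 := by
    linarith [div_neg_of_neg_of_pos hαneg hu, div_neg_of_neg_of_pos hβneg hv,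
      div_neg_of_neg_of_pos hγneg hw]
  have hS₂ : γ / u + α / v + β / w < 0 := by
    linarith [div_neg_of_neg_of_pos hγneg hu, div_neg_of_neg_of_pos hαneg hv,
      div_neg_of_neg_of_pos hβneg hw]
  have hne := bary_ne_bary hD hsum hsum' hxy
  set m := v * (C 1 - A 1) - t * w * (A 1 - B 1) with hm
  set n := -(v * (C 0 - A 0) - t * w * (A 0 - B 0)) with hn
  set k := v * (C 0 * A 1 - C 1 * A 0) - t * w * (A 0 * B 1 - A 1 * B 0) with hk
  have heval (x y z : ℝ) (h : x + y + z ≠ 0) :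
      m * bary A B C x y z 0 + n * bary A B C x y z 1 + k =
        doubleArea A B C * (v * y - t * w * z) / (x + y + z) := by
    rw [bary_apply, bary_apply, hm, hn, hk, doubleArea]
    field_simp
    ring
  have hP := heval x y z hsum
  have hQ := heval x' y' z' hsum'
  rw [hyz, sub_self, mul_zero, zero_div] at hP
  rw [hyz', sub_self, mul_zero, zero_div] at hQ
  have h1 := infDist_line_mul_sqrt hne hP hQ (bary A B C (α / u) (β / v) (γ / w))
  have h2 := infDist_line_mul_sqrt hne hP hQ (bary A B C (γ / u) (α / v) (β / w))
  rw [heval _ _ _ hS₁.ne] at h1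
  rw [heval _ _ _ hS₂.ne] at h2
  have ha2 := dist_sq_eq_coord B C
  have hb2 := dist_sq_eq_coord C A
  have hc2 := dist_sq_eq_coord A B
  rw [ha] at ha2
  rw [hb] at hb2
  rw [hc] at hc2
  have hmn : m ^ 2 + n ^ 2 = (w + u) ^ 2 * v ^ 2 + (u + v) ^ 2 * (t * w) ^ 2
      + ((w + u) ^ 2 + (u + v) ^ 2 - (v + w) ^ 2) * (v * w * t) := by
    rw [ha2, hb2, hc2, hm, hn]
    ring
  have hpos : 0 < m ^ 2 + n ^ 2 := by
    have : m ^ 2 + n ^ 2 = (u ^ 2 + 2 * u * w) * v ^ 2 + (u ^ 2 + 2 * u * v) * (t * w) ^ 2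
        + 2 * (u + v + w) * u * v * w * t + t * (v * w) ^ 2 := by
      rw [hmn]
      linear_combination (v * w) ^ 2 * ht2
    rw [this]
    positivity
  have hprod : (v * (β / v) - t * w * (γ / w)) * (v * (α / v) - t * w * (β / w)) =
      4 * (m ^ 2 + n ^ 2) := by
    rw [hmn, hα, hβ, hγ]
    field_simp
    linear_combination
      4 * ((u * v + v * w + w * u) ^ 2 + u * v * w * (u + v + w)) * ht2
  have hmul := congrArg₂ (· * ·) h1 h2
  rw [← abs_mul] at hmul
  have hval : doubleArea A B C * (v * (β / v) - t * w * (γ / w)) / (α / u + β / v + γ / w) *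
      (doubleArea A B C * (v * (α / v) - t * w * (β / w)) / (γ / u + α / v + β / w)) =
      16 * ((u + v + w) * u * v * w) /
        ((α / u + β / v + γ / w) * (γ / u + α / v + β / w)) * (m ^ 2 + n ^ 2) := by
    rw [div_mul_div_comm, div_mul_eq_mul_div]
    congr 1
    linear_combination doubleArea A B C ^ 2 * hprod + 4 * (m ^ 2 + n ^ 2) * hD2
  have hSS := mul_pos_of_neg_of_neg hS₁ hS₂
  rw [hval, abs_of_nonneg (by positivity)] at hmul
  apply mul_right_cancel₀ hpos.ne'
  rw [← hmul]
  nth_rewrite 1 [← Real.mul_self_sqrt hpos.le]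
  ring

/-- The two CCP solution triangles `T1` and `T2` share their Brocard inellipse: there is a
`ρ > 0` such that each of the six side lines of `T1` and `T2` is tangent to the ellipse
with foci `Ω1, Ω2` and minor semi-axis `ρ`, i.e. the product of the distances from the
foci to each side line equals `ρ²`. -/
theorem ccp_solutions_share_brocard_inellipse
    (A B C : EuclideanSpace ℝ (Fin 2)) (hABC : AffineIndependent ℝ ![A, B, C])
    (a b c s u v w φ : ℝ)
    (ha : a = dist B C) (hb : b = dist C A) (hc : c = dist A B)
    (hs : s = (a + b + c) / 2)
    (hu : u = s - a) (hv : v = s - b) (hw : w = s - c)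
    (hφ : φ = (1 + Real.sqrt 5) / 2)
    (V1 V2 V3 : EuclideanSpace ℝ (Fin 2))
    (hV1 : V1 = bary A B C (φ ^ 2 / u) (1 / v) ((φ - 1) ^ 2 / w))
    (hV2 : V2 = bary A B C ((φ - 2) ^ 2 / u) (1 / v) ((φ - 1) ^ 2 / w))
    (hV3 : V3 = bary A B C ((φ - 2) ^ 2 / u) ((2 * φ - 3) ^ 2 / v) ((φ - 1) ^ 2 / w))
    (W1 W2 W3 : EuclideanSpace ℝ (Fin 2))
    (hW1 : W1 = bary A B C (1 / u) (φ ^ 2 / v) ((φ + 1) ^ 2 / w))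
    (hW2 : W2 = bary A B C ((2 * φ + 1) ^ 2 / u) (φ ^ 2 / v) ((φ + 1) ^ 2 / w))
    (hW3 : W3 = bary A B C ((2 * φ + 1) ^ 2 / u) ((3 * φ + 2) ^ 2 / v) ((φ + 1) ^ 2 / w))
    (α β γ : ℝ)
    (hα : α = (a - b) ^ 2 - (a + b) * c)
    (hβ : β = (b - c) ^ 2 - (b + c) * a)
    (hγ : γ = (c - a) ^ 2 - (c + a) * b)
    (Ω1 Ω2 : EuclideanSpace ℝ (Fin 2))
    (hΩ1 : Ω1 = bary A B C (α / u) (β / v) (γ / w))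
    (hΩ2 : Ω2 = bary A B C (γ / u) (α / v) (β / w)) :
    ∃ ρ : ℝ, 0 < ρ ∧
      ∀ ℓ ∈ ({(affineSpan ℝ {V1, V2} : Set (EuclideanSpace ℝ (Fin 2))),
               (affineSpan ℝ {V2, V3} : Set (EuclideanSpace ℝ (Fin 2))),
               (affineSpan ℝ {V3, V1} : Set (EuclideanSpace ℝ (Fin 2))),
               (affineSpan ℝ {W1, W2} : Set (EuclideanSpace ℝ (Fin 2))),
               (affineSpan ℝ {W2, W3} : Set (EuclideanSpace ℝ (Fin 2))),
               (affineSpan ℝ {W3, W1} : Set (EuclideanSpace ℝ (Fin 2)))} :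
              Set (Set (EuclideanSpace ℝ (Fin 2)))),
        Metric.infDist Ω1 ℓ * Metric.infDist Ω2 ℓ = ρ ^ 2 := by
  have tri {X Y Z : EuclideanSpace ℝ (Fin 2)} (h : ¬ Collinear ℝ {X, Y, Z}) :
      dist X Z < dist X Y + dist Y Z :=
    dist_lt_dist_add_dist_iff.2 fun hw => h hw.collinear
  have hcol : ¬ Collinear ℝ {A, B, C} := affineIndependent_iff_not_collinear_set.1 hABC
  have hu0 : 0 < u := by
    have := tri (X := B) (Y := A) (Z := C) (by rwa [Set.insert_comm])
    rw [dist_comm B A, dist_comm A C, ← ha, ← hb, ← hc] at this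
    linarith
  have hv0 : 0 < v := by
    have := tri (X := A) (Y := B) (Z := C) hcol
    rw [dist_comm A C, ← ha, ← hb, ← hc] at this
    linarith
  have hw0 : 0 < w := by
    have := tri (X := A) (Y := C) (Z := B) (by rwa [Set.pair_comm C B])
    rw [dist_comm A C, dist_comm C B, ← ha, ← hb, ← hc] at this
    linarith
  have ha' : dist B C = v + w := by linarith
  have hb' : dist C A = w + u := by linarith
  have hc' : dist A B = u + v := by linarith
  have ea : a = v + w := by linarith
  have eb : b = w + u := by linarith
  have ec : c = u + v := by linarith
  have hα' : α = -2 * (2 * u * v + v * w + w * u) := by rw [hα, ea, eb, ec]; ring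
  have hβ' : β = -2 * (u * v + 2 * v * w + w * u) := by rw [hβ, ea, eb, ec]; ring
  have hγ' : γ = -2 * (u * v + v * w + 2 * w * u) := by rw [hγ, ea, eb, ec]; ring
  clear hα hβ hγ ha hb hc hs hu hv hw ea eb ec hcol tri
  have h5 : Real.sqrt 5 ^ 2 = 5 := Real.sq_sqrt (by norm_num)
  have hφ2 : φ ^ 2 = φ + 1 := by rw [hφ]; linear_combination h5 / 4
  have h5lo : 111 / 50 < Real.sqrt 5 := Real.lt_sqrt_of_sq_lt (by norm_num)
  have h5hi : Real.sqrt 5 < 56 / 25 := by nlinarith [Real.sqrt_nonneg 5]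
  have hφ1 : 161 / 100 < φ := by linarith
  have hφlt : φ < 81 / 50 := by linarith
  clear hφ h5 h5lo h5hi
  have hsq1 : (φ - 1) ^ 2 = 2 - φ := by linear_combination hφ2
  have hsq2 : (φ - 2) ^ 2 = 5 - 3 * φ := by linear_combination hφ2
  have hsq3 : (2 * φ - 3) ^ 2 = 13 - 8 * φ := by linear_combination 4 * hφ2
  have hsq4 : (φ + 1) ^ 2 = 3 * φ + 2 := by linear_combination hφ2
  have hsq5 : (2 * φ + 1) ^ 2 = 8 * φ + 5 := by linear_combination 4 * hφ2
  have hsq6 : (3 * φ + 2) ^ 2 = 21 * φ + 13 := by linear_combination 9 * hφ2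
  simp only [hφ2, hsq1, hsq2, hsq3, hsq4, hsq5, hsq6] at hV1 hV2 hV3 hW1 hW2 hW3
  set R := 16 * ((u + v + w) * u * v * w) /
    ((α / u + β / v + γ / w) * (γ / u + α / v + β / w)) with hR
  have side_yz {t p q r p' q' r' : ℝ} (ht : 0 < t) (ht2 : t ^ 2 + 1 = 3 * t)
      (hp : 0 < p) (hq : 0 < q) (hr : 0 < r) (hp' : 0 < p') (hq' : 0 < q') (hr' : 0 < r')
      (h : q = t * r) (h' : q' = t * r') (hne : p * q' ≠ p' * q) :
      Metric.infDist Ω1 (affineSpan ℝ {bary A B C (p / u) (q / v) (r / w),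
          bary A B C (p' / u) (q' / v) (r' / w)} : Set (EuclideanSpace ℝ (Fin 2))) *
        Metric.infDist Ω2 (affineSpan ℝ {bary A B C (p / u) (q / v) (r / w),
          bary A B C (p' / u) (q' / v) (r' / w)} : Set (EuclideanSpace ℝ (Fin 2))) = R := by
    rw [hΩ1, hΩ2]
    refine infDist_mul_infDist_side hu0 hv0 hw0 ha' hb' hc' ht ht2 hα' hβ' hγ'
      (by positivity) (by positivity) ?_ ?_ ?_
    · field_simp
      exact h
    · field_simp
      exact h'
    · rw [div_mul_div_comm, div_mul_div_comm]
      exact fun he => hne ((div_left_inj' (by positivity)).1 he)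
  have side_zx {t p q r p' q' r' : ℝ} (ht : 0 < t) (ht2 : t ^ 2 + 1 = 3 * t)
      (hp : 0 < p) (hq : 0 < q) (hr : 0 < r) (hp' : 0 < p') (hq' : 0 < q') (hr' : 0 < r')
      (h : r = t * p) (h' : r' = t * p') (hne : q * r' ≠ q' * r) :
      Metric.infDist Ω1 (affineSpan ℝ {bary A B C (p / u) (q / v) (r / w),
          bary A B C (p' / u) (q' / v) (r' / w)} : Set (EuclideanSpace ℝ (Fin 2))) *
        Metric.infDist Ω2 (affineSpan ℝ {bary A B C (p / u) (q / v) (r / w),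
          bary A B C (p' / u) (q' / v) (r' / w)} : Set (EuclideanSpace ℝ (Fin 2))) = R := by
    rw [hΩ1, hΩ2]
    simp only [bary_rotate A B C]
    refine (infDist_mul_infDist_side hv0 hw0 hu0 hb' hc' ha' ht ht2
      (by linarith) (by linarith) (by linarith)
      (by positivity) (by positivity) ?_ ?_ ?_).trans ?_
    · field_simp
      exact h
    · field_simp
      exact h'
    · rw [div_mul_div_comm, div_mul_div_comm]
      exact fun he => hne ((div_left_inj' (by positivity)).1 he)
    · rw [hR]
      congr 1 <;> ring
  have side_xy {t p q r p' q' r' : ℝ} (ht : 0 < t) (ht2 : t ^ 2 + 1 = 3 * t)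
      (hp : 0 < p) (hq : 0 < q) (hr : 0 < r) (hp' : 0 < p') (hq' : 0 < q') (hr' : 0 < r')
      (h : p = t * q) (h' : p' = t * q') (hne : r * p' ≠ r' * p) :
      Metric.infDist Ω1 (affineSpan ℝ {bary A B C (p / u) (q / v) (r / w),
          bary A B C (p' / u) (q' / v) (r' / w)} : Set (EuclideanSpace ℝ (Fin 2))) *
        Metric.infDist Ω2 (affineSpan ℝ {bary A B C (p / u) (q / v) (r / w),
          bary A B C (p' / u) (q' / v) (r' / w)} : Set (EuclideanSpace ℝ (Fin 2))) = R := by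
    rw [hΩ1, hΩ2]
    simp only [bary_rotate A B C, bary_rotate B C A]
    refine (infDist_mul_infDist_side hw0 hu0 hv0 hc' ha' hb' ht ht2
      (by linarith) (by linarith) (by linarith)
      (by positivity) (by positivity) ?_ ?_ ?_).trans ?_
    · field_simp
      exact h
    · field_simp
      exact h'
    · rw [div_mul_div_comm, div_mul_div_comm]
      exact fun he => hne ((div_left_inj' (by positivity)).1 he)
    · rw [hR]
      congr 1 <;> ring
  have hα0 : 0 < -α := by rw [hα', neg_mul, neg_neg]; positivity
  have hβ0 : 0 < -β := by rw [hβ', neg_mul, neg_neg]; positivity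
  have hγ0 : 0 < -γ := by rw [hγ', neg_mul, neg_neg]; positivity
  have hRpos : 0 < R := by
    have hS : (α / u + β / v + γ / w) * (γ / u + α / v + β / w) =
        (-α / u + -β / v + -γ / w) * (-γ / u + -α / v + -β / w) := by ring
    rw [hR, hS]
    positivity
  have ht1 : (φ + 1) ^ 2 + 1 = 3 * (φ + 1) := by linear_combination hφ2
  have ht2 : (2 - φ) ^ 2 + 1 = 3 * (2 - φ) := by linear_combination hφ2
  have ht1pos : 0 < φ + 1 := by linarith
  have ht2pos : 0 < 2 - φ := by linarith
  refine ⟨Real.sqrt R, Real.sqrt_pos.2 hRpos, fun ℓ hℓ => ?_⟩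
  rw [Real.sq_sqrt hRpos.le]
  simp only [Set.mem_insert_iff, Set.mem_singleton_iff] at hℓ
  rcases hℓ with rfl | rfl | rfl | rfl | rfl | rfl
  · rw [hV1, hV2]
    apply side_yz ht1pos ht1 <;> linarith
  · rw [hV2, hV3]
    apply side_zx ht1pos ht1 <;> linarith
  · rw [hV3, hV1]
    apply side_xy ht1pos ht1 <;> linarith
  · rw [hW1, hW2]
    apply side_yz ht2pos ht2 <;> linarith
  · rw [hW2, hW3]
    apply side_zx ht2pos ht2 <;> linarith
  · rw [hW3, hW1]
    apply side_xy ht2pos ht2 <;> linarith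
end
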